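/- arXiv:1907.13094 — 2 statements merged into one kernel-verified Lean document; each statement's English description precedes it below -/
import Mathlib

section
/- For every integer i ≥ 1, one has 𝔡_i² 𝔡_{i+1} = 𝔡_i 𝔡_{i+1} 𝔡_i as operators on weak compositions. -/
namespace CompOps

/-- Subtract 1 from the rightmost part equal to `i`; `none` if no part equals `i`. -/
def removeAux (i : ℕ) : List ℕ → Option (List ℕ)
  | [] => none
  | x :: xs =>
    match removeAux i xs with
    | some ys => some (x :: ys)
    | none => if x = i then some ((i - 1) :: xs) else none

/-- The box removing operator `𝔡ᵢ`, acting on weak compositions together with a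
formal zero (`none`); `𝔡₀` is the identity. -/
def d : ℕ → Option (List ℕ) → Option (List ℕ)
  | 0, o => o
  | i + 1, o => o.bind (removeAux (i + 1))

/-- The appending operator `aᵢ`, appending a part `i` at the end. -/
def a (i : ℕ) : Option (List ℕ) → Option (List ℕ) :=
  Option.map (fun l => l ++ [i])

/-- `𝔡_I` for a finite set `I = {i₁ < ⋯ < i_k}`: the composite
`𝔡_{i₁}𝔡_{i₂}⋯𝔡_{i_k}`, where `𝔡_{i_k}` (the largest index) acts first. -/
def dSet (I : Finset ℕ) : Option (List ℕ) → Option (List ℕ) :=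
  (I.sort (· ≤ ·)).foldr (fun i f => d i ∘ f) id

/-- The jdt operator `𝔲ᵢ = aᵢ 𝔡_{[i-1]}` (with `𝔲₀` the identity). -/
def u : ℕ → Option (List ℕ) → Option (List ℕ)
  | 0 => id
  | i + 1 => a (i + 1) ∘ dSet (Finset.Icc 1 i)

/-- Add 1 to the leftmost part equal to `j`; `none` if no part equals `j`. -/
def addAux (j : ℕ) : List ℕ → Option (List ℕ)
  | [] => none
  | x :: xs => if x = j then some ((x + 1) :: xs) else (addAux j xs).map (x :: ·)

/-- The box adding operator `𝔱ᵢ`: `𝔱₁` prepends a part 1, and for `i ≥ 2`, `𝔱ᵢ`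
adds 1 to the leftmost part equal to `i - 1` (formal zero if there is none). -/
def t : ℕ → Option (List ℕ) → Option (List ℕ)
  | 0 => id
  | 1 => Option.map (fun l => 1 :: l)
  | i + 2 => fun o => o.bind (addAux (i + 1))

/-- Removing from a list with a prepended part. -/
theorem removeAux_cons (i x : ℕ) (xs : List ℕ) :
    removeAux i (x :: xs) =
      match removeAux i xs with
      | some ys => some (x :: ys)
      | none => if x = i then some ((i - 1) :: xs) else none := rfl

theorem removeAux_eq_none_iff (i : ℕ) (l : List ℕ) :
    removeAux i l = none ↔ l.count i = 0 := by
  induction l with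
  | nil => simp [removeAux]
  | cons x xs ih =>
    rw [removeAux_cons, List.count_cons]
    cases h : removeAux i xs <;> grind

theorem count_of_removeAux_eq_some {i : ℕ} {l l' : List ℕ} (h : removeAux i l = some l') (j : ℕ) :
    l'.count j + (if j = i then 1 else 0) = l.count j + (if j = i - 1 then 1 else 0) := by
  induction l generalizing l' with
  | nil => simp [removeAux] at h
  | cons x xs ih =>
    rw [removeAux_cons] at h
    cases hxs : removeAux i xs with
    | none => grind [removeAux_eq_none_iff]
    | some ys =>
      have := ih hxs
      grind

theorem removeAux_braid (i : ℕ) (hi : 1 ≤ i) (l : List ℕ) :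
    ((removeAux (i + 1) l).bind (removeAux i)).bind (removeAux i) =
      ((removeAux i l).bind (removeAux (i + 1))).bind (removeAux i) := by
  induction l with
  | nil => simp [removeAux]
  | cons x xs ih =>
    have hi1 : i - 1 ≠ i := by omega
    have nA := removeAux_eq_none_iff (i + 1)
    have nB := removeAux_eq_none_iff i
    cases hA : removeAux (i + 1) xs with
    | none =>
      cases hB : removeAux i xs with
      | none =>
        clear nA nB
        by_cases h1 : x = i <;> by_cases h2 : x = i + 1 <;>
          simp_all [removeAux_cons]
      | some ws =>
        have c := count_of_removeAux_eq_some hB (i + 1)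
        have hW : removeAux (i + 1) ws = none := by
          rw [nA] at hA ⊢
          split_ifs at c <;> omega
        clear nA nB
        by_cases h1 : x = i <;> by_cases h2 : x = i + 1 <;>
          cases hV : removeAux i ws <;> simp_all [removeAux_cons]
    | some ys =>
      have c := count_of_removeAux_eq_some hA i
      simp only [add_tsub_cancel_right, if_true, Nat.left_eq_add, one_ne_zero, if_false] at c
      cases hY : removeAux i ys with
      | none =>
        rw [nB] at hY
        omega
      | some zs =>
        have c2 := count_of_removeAux_eq_some hY i
        simp only [if_true, hi1.symm, if_false] at c2
        cases hB : removeAux i xs with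
        | none =>
          have hZ : removeAux i zs = none := by
            rw [nB] at hB ⊢
            omega
          clear nA nB
          by_cases h1 : x = i <;> by_cases h2 : x = i + 1 <;>
            simp_all [removeAux_cons]
        | some ws =>
          have c3 := count_of_removeAux_eq_some hB (i + 1)
          have hA' : ¬ xs.count (i + 1) = 0 := by simp [← nA, hA]
          cases hW : removeAux (i + 1) ws with
          | none =>
            rw [nA] at hW
            split_ifs at c3 <;> omega
          | some vs =>
            have hB' : ¬ xs.count i = 0 := by simp [← nB, hB]
            cases hZ : removeAux i zs with
            | none =>
              rw [nB] at hZ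
              omega
            | some us =>
              simp only [hA, hB, hY, hW, hZ, Option.bind_some] at ih
              by_cases h1 : x = i <;> by_cases h2 : x = i + 1 <;>
                simp [removeAux_cons, hA, hB, hY, hW, hZ, ← ih, h1, h2]

/-- Lemma 2.10: `𝔡ᵢ² 𝔡_{i+1} = 𝔡ᵢ 𝔡_{i+1} 𝔡ᵢ` for every `i ≥ 1`. -/
theorem d_braid_one (i : ℕ) (hi : 1 ≤ i) (α : List ℕ) :
    d i (d i (d (i + 1) (some α))) = d i (d (i + 1) (d i (some α))) := by
  obtain ⟨k, rfl⟩ := Nat.exists_eq_add_of_le' hi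
  exact removeAux_braid (k + 1) hi α

end CompOps
end

section
/- For every integer i ≥ 1, one has 𝔲_i 𝔡_i = 𝔡_{i+1} 𝔲_{i+1} as operators on weak compositions. -/
namespace CompOps

theorem removeAux_append_singleton (i : ℕ) (l : List ℕ) :
    removeAux i (l ++ [i]) = some (l ++ [i - 1]) := by
  induction l with
  | nil => simp [removeAux]
  | cons x xs ih => simp [removeAux, ih]

theorem d_succ_a_succ (i : ℕ) (o : Option (List ℕ)) :
    d (i + 1) (a (i + 1) o) = a i o := by
  cases o <;> simp [d, a, removeAux_append_singleton]

theorem sort_Icc_one_succ (i : ℕ) :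
    (Finset.Icc 1 (i + 1)).sort (· ≤ ·) = (Finset.Icc 1 i).sort (· ≤ ·) ++ [i + 1] := by
  refine List.Perm.eq_of_pairwise' (r := (· ≤ ·)) (Finset.pairwise_sort _ _) ?_ ?_
  · rw [List.pairwise_append]
    refine ⟨Finset.pairwise_sort _ _, List.pairwise_singleton _ _, fun x hx y hy => ?_⟩
    simp only [Finset.mem_sort, Finset.mem_Icc, List.mem_singleton] at hx hy
    omega
  · rw [List.perm_ext_iff_of_nodup (Finset.sort_nodup _ _)]
    · intro x
      simp only [Finset.mem_sort, Finset.mem_Icc, List.mem_append, List.mem_singleton]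
      omega
    · refine List.Nodup.append (Finset.sort_nodup _ _) (List.nodup_singleton _) ?_
      simp

theorem foldr_d_comp (l : List ℕ) (g : Option (List ℕ) → Option (List ℕ)) :
    l.foldr (fun i f => d i ∘ f) g = l.foldr (fun i f => d i ∘ f) id ∘ g := by
  induction l with
  | nil => rfl
  | cons x xs ih => simp only [List.foldr_cons, ih, Function.comp_assoc]

theorem dSet_Icc_one_succ (i : ℕ) :
    dSet (Finset.Icc 1 (i + 1)) = dSet (Finset.Icc 1 i) ∘ d (i + 1) := by
  rw [dSet, sort_Icc_one_succ, List.foldr_append, foldr_d_comp]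
  rfl

/-- Lemma 2.13: `𝔲ᵢ 𝔡ᵢ = 𝔡_{i+1} 𝔲_{i+1}` for every `i ≥ 1`. -/
theorem u_d_eq_d_u (i : ℕ) (hi : 1 ≤ i) (α : List ℕ) :
    u i (d i (some α)) = d (i + 1) (u (i + 1) (some α)) := by
  obtain ⟨k, rfl⟩ := Nat.exists_eq_add_of_le' hi
  simp only [u, Function.comp_apply, d_succ_a_succ, dSet_Icc_one_succ]

end CompOps
end
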